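/- Let n, m ≥ 1 and C = n + m. For all integers 1 ≤ i ≤ n and 1 ≤ j, j' ≤ m, there is no timed walk p on the directed cycle with C vertices and unit edge costs satisfying all three of: (1) p(2iC) = i − 1 or p(2iC + C − 1) = i − 1; (2) p(2iC + (n + j − i)) = n + j − 1; (3) p(2iC + C − (m − j' + i) − 1) = n + j' − 1. -/

import Mathlib

/-- In `k` time steps a timed walk advances by at most `k`. -/
theorem exists_advance_le {R : Type*} [AddMonoidWithOne R] {p : ℕ → R}
    (hp : ∀ t : ℕ, p (t + 1) = p t ∨ p (t + 1) = p t + 1) (t k : ℕ) :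
    ∃ d ≤ k, p (t + k) = p t + (d : R) := by
  induction k with
  | zero => exact ⟨0, le_rfl, by simp⟩
  | succ k ih =>
    obtain ⟨d, hd, h⟩ := ih
    rcases hp (t + k) with h' | h'
    · exact ⟨d, by omega, by rw [← add_assoc, h', h]⟩
    · exact ⟨d + 1, by omega, by rw [← add_assoc, h', h, Nat.cast_succ, add_assoc]⟩

theorem ZMod.natCast_ne_of_lt_of_lt_add {C x y : ℕ} (hxy : x < y) (hyx : y < x + C) :
    (x : ZMod C) ≠ (y : ZMod C) := by
  intro h
  have hdvd : C ∣ y - x := (Nat.modEq_iff_dvd' hxy.le).1 ((ZMod.natCast_eq_natCast_iff x y C).1 h)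
  have := Nat.le_of_dvd (by omega) hdvd
  omega


/-- On the directed cycle with `C = n + m` vertices and unit edge costs (a timed walk
is a position function `p : ℕ → ZMod C` that at each time step either stays or moves
to the cyclic successor; the walk is at vertex `v_q` at time `t` iff `p t = q - 1`),
no timed walk can satisfy simultaneously:
(1) `p (2iC) = i - 1` or `p (2iC + C - 1) = i - 1`;
(2) `p (2iC + (n + j - i)) = n + j - 1`;
(3) `p (2iC + C - (m - j' + i) - 1) = n + j' - 1`. -/
theorem stmt12 (n m : ℕ) (hn : 1 ≤ n) (hm : 1 ≤ m) (C : ℕ) (hC : C = n + m)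
    (i j j' : ℕ) (hi1 : 1 ≤ i) (hin : i ≤ n) (hj1 : 1 ≤ j) (hjm : j ≤ m)
    (hj'1 : 1 ≤ j') (hj'm : j' ≤ m) :
    ¬ ∃ p : ℕ → ZMod C,
      (∀ t : ℕ, p (t + 1) = p t ∨ p (t + 1) = p t + 1) ∧
      (p (2 * i * C) = ((i - 1 : ℕ) : ZMod C) ∨
        p (2 * i * C + C - 1) = ((i - 1 : ℕ) : ZMod C)) ∧
      p (2 * i * C + (n + j - i)) = ((n + j - 1 : ℕ) : ZMod C) ∧
      p (2 * i * C + C - (m - j' + i) - 1) = ((n + j' - 1 : ℕ) : ZMod C) := by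
  rintro ⟨p, hp, h0 | h1, h2, h3⟩
  · obtain ⟨d, hd, h⟩ := exists_advance_le hp (2 * i * C) (n + j' - i - 1)
    rw [show 2 * i * C + (n + j' - i - 1) = 2 * i * C + C - (m - j' + i) - 1 by omega,
      h0, h3, ← Nat.cast_add] at h
    exact ZMod.natCast_ne_of_lt_of_lt_add (by omega) (by omega) h.symm
  · obtain ⟨d, hd, h⟩ := exists_advance_le hp (2 * i * C + (n + j - i)) (m - j + i - 1)
    rw [show 2 * i * C + (n + j - i) + (m - j + i - 1) = 2 * i * C + C - 1 by omega,
      h1, h2, ← Nat.cast_add] at h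
    exact ZMod.natCast_ne_of_lt_of_lt_add (by omega) (by omega) h
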